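/- Let X be a topological space and let A and B be subsets of X. If A and B are a-locally closed, then A ∩ B is a-locally closed. -/

import Mathlib

open Set Topology

/-- A set is regular open if it equals the interior of its closure. -/
def RegOpen {X : Type*} [TopologicalSpace X] (U : Set X) : Prop :=
  U = interior (closure U)

/-- The δ-interior of `A`: the union of all regular open sets contained in `A`. -/
def deltaInt {X : Type*} [TopologicalSpace X] (A : Set X) : Set X :=
  ⋃₀ {U : Set X | RegOpen U ∧ U ⊆ A}

/-- The δ-closure of `A`: the complement of the δ-interior of the complement. -/
def deltaCl {X : Type*} [TopologicalSpace X] (A : Set X) : Set X :=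
  (deltaInt Aᶜ)ᶜ

/-- `A` is a-open if `A ⊆ int(cl(δ-int A))`. -/
def AOpen {X : Type*} [TopologicalSpace X] (A : Set X) : Prop :=
  A ⊆ interior (closure (deltaInt A))

/-- `A` is a-closed if its complement is a-open. -/
def AClosed {X : Type*} [TopologicalSpace X] (A : Set X) : Prop :=
  AOpen Aᶜ

/-- `A` is a-locally closed if it is the intersection of an a-open and an a-closed set. -/
def ALocallyClosed {X : Type*} [TopologicalSpace X] (A : Set X) : Prop :=
  ∃ U V : Set X, AOpen U ∧ AClosed V ∧ A = U ∩ V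

/-- `A` is e-open if `A ⊆ cl(δ-int A) ∪ int(δ-cl A)`. -/
def EOpen {X : Type*} [TopologicalSpace X] (A : Set X) : Prop :=
  A ⊆ closure (deltaInt A) ∪ interior (deltaCl A)

/-- `A` is e-closed if its complement is e-open. -/
def EClosed {X : Type*} [TopologicalSpace X] (A : Set X) : Prop :=
  EOpen Aᶜ

/-- `A` is e-locally closed if it is the intersection of an e-open and an e-closed set. -/
def ELocallyClosed {X : Type*} [TopologicalSpace X] (A : Set X) : Prop :=
  ∃ U V : Set X, EOpen U ∧ EClosed V ∧ A = U ∩ V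

/-- The a-closure of `A`: the intersection of all a-closed supersets of `A`. -/
def aCl {X : Type*} [TopologicalSpace X] (A : Set X) : Set X :=
  ⋂₀ {F : Set X | AClosed F ∧ A ⊆ F}

/-- The a-interior of `A`: the union of all a-open subsets of `A`. -/
def aInt {X : Type*} [TopologicalSpace X] (A : Set X) : Set X :=
  ⋃₀ {U : Set X | AOpen U ∧ U ⊆ A}

/-- The e-closure of `A`: the intersection of all e-closed supersets of `A`. -/
def eCl {X : Type*} [TopologicalSpace X] (A : Set X) : Set X :=
  ⋂₀ {F : Set X | EClosed F ∧ A ⊆ F}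

/-- `S` is semi-open if `S ⊆ cl(int S)`. -/
def SemiOpen {X : Type*} [TopologicalSpace X] (S : Set X) : Prop :=
  S ⊆ closure (interior S)

/-- `S` is semi-closed if its complement is semi-open. -/
def SemiClosed {X : Type*} [TopologicalSpace X] (S : Set X) : Prop :=
  SemiOpen Sᶜ

/-- The semi-closure of `U`: the intersection of all semi-closed supersets of `U`. -/
def sCl {X : Type*} [TopologicalSpace X] (U : Set X) : Set X :=
  ⋂₀ {F : Set X | SemiClosed F ∧ U ⊆ F}

/-- `A` is feebly open if there is an open `U` with `U ⊆ A ⊆ scl(U)`. -/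
def FeeblyOpen {X : Type*} [TopologicalSpace X] (A : Set X) : Prop :=
  ∃ U : Set X, IsOpen U ∧ U ⊆ A ∧ A ⊆ sCl U

/-- `A` is feebly closed if its complement is feebly open. -/
def FeeblyClosed {X : Type*} [TopologicalSpace X] (A : Set X) : Prop :=
  FeeblyOpen Aᶜ

/-- `A` is feebly locally closed if it is the intersection of a feebly open and a
feebly closed set. -/
def FeeblyLocallyClosed {X : Type*} [TopologicalSpace X] (A : Set X) : Prop :=
  ∃ U V : Set X, FeeblyOpen U ∧ FeeblyClosed V ∧ A = U ∩ V

/-- `A` is α-open if `A ⊆ int(cl(int A))`. -/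
def AlphaOpen {X : Type*} [TopologicalSpace X] (A : Set X) : Prop :=
  A ⊆ interior (closure (interior A))

/-- `A` is α-closed if its complement is α-open. -/
def AlphaClosed {X : Type*} [TopologicalSpace X] (A : Set X) : Prop :=
  AlphaOpen Aᶜ

/-- `A` is α-locally closed if it is the intersection of an α-open and an α-closed set. -/
def AlphaLocallyClosed {X : Type*} [TopologicalSpace X] (A : Set X) : Prop :=
  ∃ U V : Set X, AlphaOpen U ∧ AlphaClosed V ∧ A = U ∩ V

/-- `X` is submaximal if every dense subset of `X` is open. -/
def Submaximal (X : Type*) [TopologicalSpace X] : Prop :=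
  ∀ A : Set X, closure A = univ → IsOpen A

/-- `X` is a-submaximal if every a-dense subset of `X` is a-open. -/
def ASubmaximal (X : Type*) [TopologicalSpace X] : Prop :=
  ∀ A : Set X, aCl A = univ → AOpen A

/-- `X` is e-submaximal if every e-dense subset of `X` is e-open. -/
def ESubmaximal (X : Type*) [TopologicalSpace X] : Prop :=
  ∀ A : Set X, eCl A = univ → EOpen A

/-- `X` is an e-space if a subset is open precisely when it is e-open. -/
def IsESpace (X : Type*) [TopologicalSpace X] : Prop :=
  ∀ A : Set X, IsOpen A ↔ EOpen A

theorem my_int_cl_inter {X : Type*} [TopologicalSpace X] {U V : Set X} (hU : IsOpen U)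
    (hV : IsOpen V) :
    interior (closure U) ∩ interior (closure V) ⊆ interior (closure (U ∩ V)) := by
  apply interior_maximal _ (isOpen_interior.inter isOpen_interior)
  rintro x ⟨hx, hy⟩
  rw [mem_closure_iff]
  intro W hW hxW
  obtain ⟨y, ⟨hyW, hyV⟩, hyU⟩ := mem_closure_iff.1 (interior_subset hx)
    (W ∩ interior (closure V)) (hW.inter isOpen_interior) ⟨hxW, hy⟩
  obtain ⟨z, ⟨hzW, hzU⟩, hzV⟩ := mem_closure_iff.1 (interior_subset hyV)
    (W ∩ U) (hW.inter hU) ⟨hyW, hyU⟩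
  exact ⟨z, hzW, hzU, hzV⟩

theorem my_regOpen_inter {X : Type*} [TopologicalSpace X] {U V : Set X} (hU : RegOpen U)
    (hV : RegOpen V) : RegOpen (U ∩ V) := by
  have oU : IsOpen U := by rw [hU]; exact isOpen_interior
  have oV : IsOpen V := by rw [hV]; exact isOpen_interior
  apply Subset.antisymm
  · exact interior_maximal subset_closure (oU.inter oV)
  · apply subset_inter
    · exact (interior_mono (closure_mono inter_subset_left)).trans hU.symm.subset
    · exact (interior_mono (closure_mono inter_subset_right)).trans hV.symm.subset

theorem my_isOpen_deltaInt {X : Type*} [TopologicalSpace X] (A : Set X) :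
    IsOpen (deltaInt A) := by
  apply isOpen_sUnion
  rintro U ⟨hU, -⟩
  rw [hU]
  exact isOpen_interior

theorem my_deltaInt_mono {X : Type*} [TopologicalSpace X] {A B : Set X} (h : A ⊆ B) :
    deltaInt A ⊆ deltaInt B := by
  rintro x ⟨U, ⟨hU, hUA⟩, hx⟩
  exact ⟨U, ⟨hU, hUA.trans h⟩, hx⟩

theorem my_aOpen_inter {X : Type*} [TopologicalSpace X] {A B : Set X} (hA : AOpen A)
    (hB : AOpen B) : AOpen (A ∩ B) := by
  rintro x ⟨hx, hy⟩
  have h := my_int_cl_inter (my_isOpen_deltaInt A) (my_isOpen_deltaInt B) ⟨hA hx, hB hy⟩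
  refine interior_mono (closure_mono ?_) h
  rintro z ⟨⟨U, ⟨hU, hUA⟩, hzU⟩, ⟨V, ⟨hV, hVB⟩, hzV⟩⟩
  exact ⟨U ∩ V, ⟨my_regOpen_inter hU hV, inter_subset_inter hUA hVB⟩, hzU, hzV⟩

theorem my_aClosed_inter {X : Type*} [TopologicalSpace X] {A B : Set X} (hA : AClosed A)
    (hB : AClosed B) : AClosed (A ∩ B) := by
  unfold AClosed at *
  rw [compl_inter]
  apply union_subset
  · exact hA.trans (interior_mono (closure_mono (my_deltaInt_mono subset_union_left)))
  · exact hB.trans (interior_mono (closure_mono (my_deltaInt_mono subset_union_right)))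

theorem aLocallyClosed_inter {X : Type*} [TopologicalSpace X] (A B : Set X)
    (hA : ALocallyClosed A) (hB : ALocallyClosed B) : ALocallyClosed (A ∩ B) := by
  obtain ⟨U, V, hU, hV, rfl⟩ := hA
  obtain ⟨U', V', hU', hV', rfl⟩ := hB
  exact ⟨U ∩ U', V ∩ V', my_aOpen_inter hU hU', my_aClosed_inter hV hV',
    inter_inter_inter_comm U V U' V'⟩
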